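/- Let A be an alphabet (a type) containing two distinct distinguished symbols 0 and 1, and let m ≥ 1. Let w, w' : {0,…,m−1} → A be words of length m, neither of which is the constant word 0^m. Define the words u = 1·w·1·0^m and u' = 1·w'·1·0^m, each of length 2m + 2 (the symbol 1, followed by the word, followed by the symbol 1, followed by m symbols 0). Then two occurrences of such words in a bi-infinite sequence cannot properly overlap: if y : ℤ → A satisfies y(p+i) = u(i) for all 0 ≤ i < 2m+2 and y(q+i) = u'(i) for all 0 ≤ i < 2m+2, and |p − q| < 2m + 2, then p = q. -/

import Mathlib

/-- The word `1 · w · 1 · 0^m` of length `2m + 2` built from a word `w` of length `m`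
over an alphabet with distinguished symbols `a0` ("0") and `a1` ("1"):
position `0` carries `1`, positions `1,…,m` carry `w`, position `m+1` carries `1`, and
positions `m+2,…,2m+1` carry `0`. -/
def markerWord {A : Type*} (a0 a1 : A) (m : ℕ) (w : ℕ → A) : ℕ → A := fun i =>
  if i = 0 then a1 else if i ≤ m then w (i - 1) else if i = m + 1 then a1 else a0

/-- A marker word with nonzero content does not occur at a position `q` that is less than
`2m + 2` to the right of an occurrence of another marker word. -/
theorem markerWord_not_lt {A : Type*} {a0 a1 : A} (h01 : a0 ≠ a1)
    {m : ℕ} {w w' : ℕ → A} (hw' : ¬ ∀ i : ℕ, i < m → w' i = a0) {y : ℤ → A} {p q : ℤ}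
    (hp : ∀ i : ℕ, i < 2 * m + 2 → y (p + i) = markerWord a0 a1 m w i)
    (hq : ∀ i : ℕ, i < 2 * m + 2 → y (q + i) = markerWord a0 a1 m w' i)
    (hpq : q - p < 2 * m + 2) : ¬ p < q := by
  intro hlt
  obtain ⟨d, rfl⟩ : ∃ d : ℕ, q = p + d := ⟨(q - p).toNat, by omega⟩
  have hzero : ∀ i : ℕ, m + 2 ≤ d + i → d + i < 2 * m + 2 → markerWord a0 a1 m w' i = a0 := by
    intro i h1 h2
    rw [← hq i (by omega), add_assoc, ← Nat.cast_add, hp _ h2]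
    simp only [markerWord]
    split_ifs <;> first | rfl | omega
  rcases lt_trichotomy d (m + 1) with h | h | h
  · have := hzero (m + 1) (by omega) (by omega)
    simp [markerWord] at this
    exact h01 this.symm
  · refine hw' fun i hi => ?_
    have := hzero (i + 1) (by omega) (by omega)
    simpa [markerWord, Nat.succ_le_of_lt hi] using this
  · have := hzero 0 (by omega) (by omega)
    simp only [markerWord, if_true] at this
    exact h01 this.symm

/-- **No proper overlaps.** If `w` and `w'` are words of length `m ≥ 1`, neither equal
to the constant word `0^m`, then two occurrences of the words `1·w·1·0^m` and
`1·w'·1·0^m` in a bi-infinite sequence at distance less than `2m + 2` must coincide in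
position. -/
theorem markerWord_no_overlap {A : Type*} (a0 a1 : A) (h01 : a0 ≠ a1)
    (m : ℕ) (hm : 1 ≤ m) (w w' : ℕ → A)
    (hw : ¬ ∀ i : ℕ, i < m → w i = a0) (hw' : ¬ ∀ i : ℕ, i < m → w' i = a0)
    (y : ℤ → A) (p q : ℤ)
    (hp : ∀ i : ℕ, i < 2 * m + 2 → y (p + i) = markerWord a0 a1 m w i)
    (hq : ∀ i : ℕ, i < 2 * m + 2 → y (q + i) = markerWord a0 a1 m w' i)
    (hpq : |p - q| < 2 * m + 2) : p = q := by
  rw [abs_lt] at hpq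
  exact le_antisymm (not_lt.mp (markerWord_not_lt h01 hw hq hp (by omega)))
    (not_lt.mp (markerWord_not_lt h01 hw' hp hq (by omega)))
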